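/- arXiv:1906.12023 — 2 statements merged into one kernel-verified Lean document; each statement's English description precedes it below -/
import Mathlib

section
/- For every integer n ≥ 0 and every nonzero complex number z whose principal argument satisfies |arg(z)| ≤ π/4, the Abramowitz function J_n(z) is nonzero. In other words, J_n has no zero in the closed sector {z ∈ ℂ : z ≠ 0, |arg z| ≤ π/4}. -/
open MeasureTheory

/-- The Abramowitz function `J_n`. -/
noncomputable def abramowitzJ (n : ℤ) (z : ℂ) : ℂ :=
  ∫ t in Set.Ioi (0 : ℝ), ((t ^ n : ℝ) : ℂ) * Complex.exp (-(t : ℂ) ^ 2 - z / (t : ℂ))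

open Filter Topology

/-- The integrand of the Abramowitz function `J_n`. -/
noncomputable def abramowitzIntegrand (n : ℤ) (z : ℂ) (t : ℝ) : ℂ :=
  ((t ^ n : ℝ) : ℂ) * Complex.exp (-(t : ℂ) ^ 2 - z / (t : ℂ))

lemma abramowitzJ_eq_integral (n : ℤ) (z : ℂ) :
    abramowitzJ n z = ∫ t in Set.Ioi (0 : ℝ), abramowitzIntegrand n z t := rfl

lemma norm_abramowitzIntegrand (n : ℤ) (z : ℂ) {t : ℝ} (ht : 0 < t) :
    ‖abramowitzIntegrand n z t‖ = t ^ n * Real.exp (-t ^ 2 - z.re / t) := by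
  rw [abramowitzIntegrand, norm_mul, Complex.norm_real, Real.norm_of_nonneg (by positivity),
    Complex.norm_exp]
  congr 2
  rw [Complex.sub_re, Complex.neg_re, Complex.div_ofReal_re, ← Complex.ofReal_pow,
    Complex.ofReal_re]

/-- The singularity of `t ^ n` at the origin is absorbed by `exp (-z / t)`, at the price of a
negative power of `re z`. -/
lemma exists_norm_abramowitzIntegrand_le (n : ℤ) :
    ∃ k j : ℕ, 1 ≤ k ∧ 1 ≤ j ∧ ∀ z : ℂ, 0 < z.re → ∀ t : ℝ, 0 < t →
      ‖abramowitzIntegrand n z t‖ ≤ k.factorial / z.re ^ k * (t ^ j * Real.exp (-t ^ 2)) := by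
  obtain ⟨j, hj⟩ : ∃ j : ℕ, (j : ℤ) = n + (n.natAbs + 1 : ℕ) :=
    ⟨(n + (n.natAbs + 1 : ℕ)).toNat, by omega⟩
  refine ⟨n.natAbs + 1, j, by omega, by omega, fun z hz t ht => ?_⟩
  set k := n.natAbs + 1
  rw [norm_abramowitzIntegrand n z ht]
  have hexp : Real.exp (-(z.re / t)) ≤ k.factorial / z.re ^ k * t ^ k := by
    have h := Real.pow_div_factorial_le_exp (z.re / t) (by positivity) k
    rw [Real.exp_neg]
    calc (Real.exp (z.re / t))⁻¹ ≤ ((z.re / t) ^ k / k.factorial)⁻¹ := by gcongr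
      _ = k.factorial / z.re ^ k * t ^ k := by
        rw [div_pow]
        field_simp
  have hpow : t ^ n * t ^ k = t ^ j := by
    rw [← zpow_natCast t k, ← zpow_natCast t j, hj, zpow_add₀ ht.ne']
  calc t ^ n * Real.exp (-t ^ 2 - z.re / t)
      = t ^ n * Real.exp (-t ^ 2) * Real.exp (-(z.re / t)) := by
        rw [sub_eq_add_neg, Real.exp_add, mul_assoc]
    _ ≤ t ^ n * Real.exp (-t ^ 2) * (k.factorial / z.re ^ k * t ^ k) := by gcongr
    _ = k.factorial / z.re ^ k * (t ^ j * Real.exp (-t ^ 2)) := by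
        rw [← hpow]
        ring

lemma integrableOn_pow_mul_exp_neg_sq (j : ℕ) :
    IntegrableOn (fun t : ℝ => t ^ j * Real.exp (-t ^ 2)) (Set.Ioi 0) := by
  have h := integrableOn_rpow_mul_exp_neg_mul_sq one_pos (s := j)
    (by linarith [j.cast_nonneg (α := ℝ)])
  simpa using h

lemma measurable_abramowitzIntegrand (n : ℤ) (z : ℂ) : Measurable (abramowitzIntegrand n z) := by
  unfold abramowitzIntegrand
  fun_prop

lemma integrableOn_abramowitzIntegrand (n : ℤ) {z : ℂ} (hz : 0 < z.re) :
    IntegrableOn (abramowitzIntegrand n z) (Set.Ioi 0) := by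
  obtain ⟨k, j, -, -, h⟩ := exists_norm_abramowitzIntegrand_le n
  refine ((integrableOn_pow_mul_exp_neg_sq j).const_mul (k.factorial / z.re ^ k)).mono'
    (measurable_abramowitzIntegrand n z).aestronglyMeasurable ?_
  filter_upwards [ae_restrict_mem measurableSet_Ioi] with t ht using h z hz t ht

lemma exists_norm_abramowitzJ_le (n : ℤ) :
    ∃ C : ℝ, 0 ≤ C ∧ ∀ z : ℂ, 1 ≤ z.re → ‖abramowitzJ n z‖ ≤ C / z.re := by
  obtain ⟨k, j, hk, -, h⟩ := exists_norm_abramowitzIntegrand_le n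
  set I := ∫ t in Set.Ioi (0 : ℝ), t ^ j * Real.exp (-t ^ 2)
  have hI : 0 ≤ I := setIntegral_nonneg measurableSet_Ioi fun t (ht : 0 < t) => by positivity
  refine ⟨k.factorial * I, by positivity, fun z hz => ?_⟩
  have hz0 : 0 < z.re := by linarith
  calc ‖abramowitzJ n z‖
      ≤ ∫ t in Set.Ioi (0 : ℝ), k.factorial / z.re ^ k * (t ^ j * Real.exp (-t ^ 2)) := by
        refine norm_integral_le_of_norm_le ((integrableOn_pow_mul_exp_neg_sq j).const_mul _) ?_
        filter_upwards [ae_restrict_mem measurableSet_Ioi] with t ht using h z hz0 t ht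
    _ = k.factorial * I / z.re ^ k := by
        rw [integral_const_mul]
        ring
    _ ≤ k.factorial * I / z.re := by
        gcongr
        exact le_self_pow₀ hz (by omega)

lemma hasDerivAt_abramowitzIntegrand (n : ℤ) (z : ℂ) {t : ℝ} (ht : 0 < t) :
    HasDerivAt (fun z => abramowitzIntegrand n z t) (-abramowitzIntegrand (n - 1) z t) z := by
  have htc : (t : ℂ) ≠ 0 := by exact_mod_cast ht.ne'
  have h := ((((hasDerivAt_id z).div_const (t : ℂ)).const_sub (-(t : ℂ) ^ 2)).cexp).const_mul
    ((t ^ n : ℝ) : ℂ)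
  refine h.congr_deriv ?_
  simp only [abramowitzIntegrand, id]
  push_cast
  rw [zpow_sub_one₀ htc]
  ring

lemma hasDerivAt_abramowitzJ (n : ℤ) {z : ℂ} (hz : 0 < z.re) :
    HasDerivAt (abramowitzJ n) (-abramowitzJ (n - 1) z) z := by
  have hopen : IsOpen {w : ℂ | z.re / 2 < w.re} := isOpen_lt continuous_const Complex.continuous_re
  have hre : 0 < (((z.re / 2 : ℝ) : ℂ)).re := by
    rw [Complex.ofReal_re]
    positivity
  have h := hasDerivAt_integral_of_dominated_loc_of_deriv_le
    (μ := volume.restrict (Set.Ioi (0 : ℝ)))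
    (F := abramowitzIntegrand n) (F' := fun w t => -abramowitzIntegrand (n - 1) w t)
    (bound := fun t => ‖abramowitzIntegrand (n - 1) ((z.re / 2 : ℝ) : ℂ) t‖)
    (hopen.mem_nhds (by simpa using half_lt_self hz))
    (Eventually.of_forall fun w => (measurable_abramowitzIntegrand n w).aestronglyMeasurable)
    (integrableOn_abramowitzIntegrand n hz)
    (measurable_abramowitzIntegrand (n - 1) z).neg.aestronglyMeasurable ?_
    (integrableOn_abramowitzIntegrand (n - 1) hre).norm ?_
  · have h2 := h.2
    rwa [integral_neg] at h2
  · filter_upwards [ae_restrict_mem measurableSet_Ioi] with t (ht : 0 < t) w hw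
    have hw' : z.re / 2 < w.re := hw
    rw [norm_neg, norm_abramowitzIntegrand _ _ ht, norm_abramowitzIntegrand _ _ ht,
      Complex.ofReal_re]
    gcongr
  · filter_upwards [ae_restrict_mem measurableSet_Ioi] with t ht w _
    exact hasDerivAt_abramowitzIntegrand n w ht

lemma tendsto_abramowitzIntegrand_zero (n : ℤ) {z : ℂ} (hz : 0 < z.re) :
    Tendsto (abramowitzIntegrand n z) (𝓝[>] 0) (𝓝 0) := by
  obtain ⟨k, j, -, hj, h⟩ := exists_norm_abramowitzIntegrand_le n
  refine squeeze_zero_norm' (a := fun t => k.factorial / z.re ^ k * (t ^ j * Real.exp (-t ^ 2)))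
    (by filter_upwards [self_mem_nhdsWithin] with t ht using h z hz t ht) ?_
  have hc : Continuous fun t : ℝ => k.factorial / z.re ^ k * (t ^ j * Real.exp (-t ^ 2)) := by
    fun_prop
  refine (hc.tendsto' 0 0 ?_).mono_left nhdsWithin_le_nhds
  simp [show j ≠ 0 by omega]

lemma tendsto_abramowitzIntegrand_atTop (n : ℤ) {z : ℂ} (hz : 0 < z.re) :
    Tendsto (abramowitzIntegrand n z) atTop (𝓝 0) := by
  obtain ⟨k, j, -, -, h⟩ := exists_norm_abramowitzIntegrand_le n
  refine squeeze_zero_norm' (a := fun t => k.factorial / z.re ^ k * (t ^ j * Real.exp (-t)))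
    ?_ ?_
  · filter_upwards [eventually_ge_atTop 1] with t ht
    have ht0 : 0 < t := by linarith
    refine (h z hz t ht0).trans ?_
    gcongr
    nlinarith
  · simpa using (Real.tendsto_pow_mul_exp_neg_atTop_nhds_zero j).const_mul
      ((k.factorial : ℝ) / z.re ^ k)

/-- The three-term recurrence, by integrating the derivative of `t ^ (n - 1) * exp (-t ^ 2 - z / t)`. -/
lemma two_mul_abramowitzJ (n : ℤ) {z : ℂ} (hz : 0 < z.re) :
    2 * abramowitzJ n z = (n - 1) * abramowitzJ (n - 2) z + z * abramowitzJ (n - 3) z := by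
  have hint := integrableOn_abramowitzIntegrand (z := z)
  have hsum : ∀ t ∈ Set.Ioi (0 : ℝ),
      ((n - 1 : ℤ) : ℂ) * (t : ℂ) ^ (n - 1 - 1) * Complex.exp (-(t : ℂ) ^ 2 - z / (t : ℂ)) +
        (t : ℂ) ^ (n - 1) * (Complex.exp (-(t : ℂ) ^ 2 - z / (t : ℂ)) *
          (-(2 * (t : ℂ)) + z / (t : ℂ) ^ 2)) =
      ((n : ℂ) - 1) * abramowitzIntegrand (n - 2) z t + z * abramowitzIntegrand (n - 3) z t -
        2 * abramowitzIntegrand n z t := by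
    intro t (ht : 0 < t)
    have htc : (t : ℂ) ≠ 0 := by exact_mod_cast ht.ne'
    simp only [abramowitzIntegrand]
    push_cast
    rw [sub_sub, one_add_one_eq_two, zpow_sub₀ htc n 2, zpow_sub₀ htc n 3, zpow_sub_one₀ htc]
    simp only [zpow_ofNat]
    field_simp
    ring
  have hI : IntegrableOn (fun t => ((n : ℂ) - 1) * abramowitzIntegrand (n - 2) z t +
      z * abramowitzIntegrand (n - 3) z t - 2 * abramowitzIntegrand n z t) (Set.Ioi 0) :=
    ((((hint (n - 2) hz).const_mul _).add ((hint (n - 3) hz).const_mul _)).sub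
      ((hint n hz).const_mul _))
  have key := integral_Ioi_deriv_mul_eq_sub (a := 0) (a' := (0 : ℂ)) (b' := (0 : ℂ))
    (u := fun t : ℝ => (t : ℂ) ^ (n - 1))
    (v := fun t : ℝ => Complex.exp (-(t : ℂ) ^ 2 - z / (t : ℂ)))
    (u' := fun t : ℝ => ((n - 1 : ℤ) : ℂ) * (t : ℂ) ^ (n - 1 - 1))
    (v' := fun t : ℝ => Complex.exp (-(t : ℂ) ^ 2 - z / (t : ℂ)) *
          (-(2 * (t : ℂ)) + z / (t : ℂ) ^ 2)) ?_ ?_ ?_ ?_ ?_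
  · rw [setIntegral_congr_fun measurableSet_Ioi hsum, integral_sub, integral_add,
      integral_const_mul, integral_const_mul, integral_const_mul] at key
    · simp only [← abramowitzJ_eq_integral] at key
      linear_combination -key
    · exact (hint (n - 2) hz).const_mul _
    · exact (hint (n - 3) hz).const_mul _
    · exact ((hint (n - 2) hz).const_mul _).add ((hint (n - 3) hz).const_mul _)
    · exact (hint n hz).const_mul _
  · intro t (ht : 0 < t)
    have htc : (t : ℂ) ≠ 0 := by exact_mod_cast ht.ne'
    exact (hasDerivAt_zpow (n - 1) (t : ℂ) (Or.inl htc)).comp_ofReal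
  · intro t (ht : 0 < t)
    have htc : (t : ℂ) ≠ 0 := by exact_mod_cast ht.ne'
    have h := (((hasDerivAt_pow 2 (t : ℂ)).neg.sub
      ((hasDerivAt_inv htc).const_mul z)).cexp).comp_ofReal
    refine (h.congr_deriv ?_)
    simp [div_eq_mul_inv]
  · exact hI.congr_fun (fun t ht => (hsum t ht).symm) measurableSet_Ioi
  · refine (tendsto_abramowitzIntegrand_zero (n - 1) hz).congr fun t => ?_
    simp [abramowitzIntegrand]
  · refine (tendsto_abramowitzIntegrand_atTop (n - 1) hz).congr fun t => ?_
    simp [abramowitzIntegrand]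

lemma abramowitzJ_one_ne_zero (n : ℤ) : abramowitzJ n 1 ≠ 0 := by
  have hn : ∀ t ∈ Set.Ioi (0 : ℝ),
      abramowitzIntegrand n 1 t = ((t ^ n * Real.exp (-t ^ 2 - 1 / t) : ℝ) : ℂ) := by
    intro t _
    simp [abramowitzIntegrand]
  have hI : IntegrableOn (fun t : ℝ => t ^ n * Real.exp (-t ^ 2 - 1 / t)) (Set.Ioi 0) := by
    refine IntegrableOn.congr_fun (integrableOn_abramowitzIntegrand n (z := 1) (by simp)).norm
      (fun t ht => ?_) measurableSet_Ioi
    simpa using norm_abramowitzIntegrand n 1 ht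
  have hpos : 0 < ∫ t in Set.Ioi (0 : ℝ), t ^ n * Real.exp (-t ^ 2 - 1 / t) := by
    rw [setIntegral_pos_iff_support_of_nonneg_ae _ hI]
    · refine lt_of_lt_of_le ?_ (measure_mono (s := Set.Ioi (0 : ℝ)) fun t (ht : 0 < t) => ⟨?_, ht⟩)
      · simp
      · exact (by positivity : 0 < t ^ n * Real.exp (-t ^ 2 - 1 / t)).ne'
    · filter_upwards [ae_restrict_mem measurableSet_Ioi] with t (ht : 0 < t)
      simp only [Pi.zero_apply]
      positivity
  rw [abramowitzJ_eq_integral, setIntegral_congr_fun measurableSet_Ioi hn, integral_complex_ofReal]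
  exact_mod_cast hpos.ne'

/-- `J_n` does not vanish identically on a ray segment of the right half-plane. -/
lemma exists_abramowitzJ_real_mul_ne_zero (n : ℤ) {z : ℂ} (hz : 0 < z.re) :
    ∃ s : ℝ, 1 < s ∧ abramowitzJ n (s * z) ≠ 0 := by
  by_contra! hzero
  have hopen : IsOpen {w : ℂ | 0 < w.re} := isOpen_lt continuous_const Complex.continuous_re
  have hana : AnalyticOnNhd ℂ (abramowitzJ n) {w : ℂ | 0 < w.re} :=
    DifferentiableOn.analyticOnNhd
      (fun w hw => (hasDerivAt_abramowitzJ n hw).differentiableAt.differentiableWithinAt) hopen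
  have hz0 : z ≠ 0 := by
    rintro rfl
    simp at hz
  have htend : Tendsto (fun s : ℝ => (s : ℂ) * z) (𝓝[>] 1) (𝓝[≠] z) := by
    refine tendsto_nhdsWithin_iff.2 ⟨?_, ?_⟩
    · have hc : Continuous fun s : ℝ => (s : ℂ) * z := by fun_prop
      exact (hc.tendsto' 1 z (by simp)).mono_left nhdsWithin_le_nhds
    · filter_upwards [self_mem_nhdsWithin] with s (hs : 1 < s) h
      have h1 : (s : ℂ) = 1 := mul_right_cancel₀ hz0 (by simpa using h)
      exact hs.ne' (by exact_mod_cast h1)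
  have hfreq : ∃ᶠ w in 𝓝[≠] z, abramowitzJ n w = 0 := by
    refine htend.frequently (Eventually.frequently ?_)
    filter_upwards [self_mem_nhdsWithin] with s hs using hzero s hs
  have heq := hana.eqOn_zero_of_preconnected_of_frequently_eq_zero
    (convex_halfSpace_re_gt 0).isPreconnected hz hfreq
  exact abramowitzJ_one_ne_zero n (heq (by simp : (1 : ℂ) ∈ {w : ℂ | 0 < w.re}))

/-- An energy along the ray through `z`: for `w s = J_n (s * z)` with first and second derivatives
`p` and `q`, it is `re (s * q * conj w) - s * ‖p‖ ^ 2 / 2 - n * re (p * conj w)`. -/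
noncomputable def abramowitzEnergy (n : ℤ) (z : ℂ) (s : ℝ) : ℝ :=
  (s * (z ^ 2 * abramowitzJ (n - 2) (s * z)) * star (abramowitzJ n (s * z))
    - s * (z * abramowitzJ (n - 1) (s * z)) * star (z * abramowitzJ (n - 1) (s * z)) / 2
    + n * (z * abramowitzJ (n - 1) (s * z)) * star (abramowitzJ n (s * z))).re

lemma hasDerivAt_abramowitzJ_real_mul (n : ℤ) {z : ℂ} (hz : 0 < z.re) {s : ℝ} (hs : 0 < s) :
    HasDerivAt (fun s : ℝ => abramowitzJ n (s * z)) (-(z * abramowitzJ (n - 1) (s * z))) s := by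
  have hsz : 0 < ((s : ℂ) * z).re := by
    rw [Complex.re_ofReal_mul]
    positivity
  have h := ((hasDerivAt_abramowitzJ n hsz).comp (s : ℂ)
    ((hasDerivAt_id (s : ℂ)).mul_const z)).comp_ofReal
  refine h.congr_deriv ?_
  ring

lemma hasDerivAt_abramowitzEnergy (n : ℤ) {z : ℂ} (hz : 0 < z.re) {s : ℝ} (hs : 0 < s) :
    HasDerivAt (abramowitzEnergy n z)
      (-(2 * (z ^ 2).re * ‖abramowitzJ n (s * z)‖ ^ 2
        + (n + 1 / 2) * ‖z * abramowitzJ (n - 1) (s * z)‖ ^ 2)) s := by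
  have hsz : 0 < ((s : ℂ) * z).re := by
    rw [Complex.re_ofReal_mul]
    positivity
  have h0 := hasDerivAt_abramowitzJ_real_mul n hz hs
  have h1 := (hasDerivAt_abramowitzJ_real_mul (n - 1) hz hs).const_mul z
  have h2 := (hasDerivAt_abramowitzJ_real_mul (n - 2) hz hs).const_mul (z ^ 2)
  have hid : HasDerivAt (fun s : ℝ => (s : ℂ)) 1 s := (hasDerivAt_id (s : ℂ)).comp_ofReal
  have h := (((hid.mul h2).mul h0.star).sub (((hid.mul h1).mul h1.star).div_const 2)).add
    ((h1.const_mul (n : ℂ)).mul h0.star)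
  have hre := Complex.reCLM.hasFDerivAt.comp_hasDerivAt s h
  refine hre.congr_deriv ?_
  have hrec := two_mul_abramowitzJ n hsz
  rw [show n - 1 - 1 = n - 2 by ring, show n - 2 - 1 = n - 3 by ring]
  simp only [Pi.mul_apply]
  have hode : s * (z ^ 2 * (z * abramowitzJ (n - 3) (s * z))) =
      z ^ 2 * (2 * abramowitzJ n (s * z)) - (n - 1) * (z ^ 2 * abramowitzJ (n - 2) (s * z)) := by
    rw [hrec]
    ring
  have hode_re := congrArg (fun w => (w * star (abramowitzJ n (s * z))).re) hode
  rw [Complex.sq_norm, Complex.sq_norm, Complex.normSq_apply, Complex.normSq_apply]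
  clear hre h h0 h1 h2 hrec hode
  generalize abramowitzJ (n - 3) (s * z) = d at *
  generalize abramowitzJ (n - 2) (s * z) = c at *
  generalize abramowitzJ (n - 1) (s * z) = b at *
  generalize abramowitzJ n (s * z) = a at *
  rw [show z ^ 2 * -(z * d) = -(z ^ 2 * (z * d)) by ring,
    show z * -(z * c) = -(z ^ 2 * c) by ring]
  generalize z ^ 2 * (z * d) = d' at *
  generalize z ^ 2 * c = c' at *
  generalize z * b = b' at *
  generalize z ^ 2 = q at *
  simp at hode_re ⊢
  linear_combination -hode_re

lemma tendsto_abramowitzEnergy (n : ℤ) {z : ℂ} (hz : 0 < z.re) :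
    Tendsto (abramowitzEnergy n z) atTop (𝓝 0) := by
  have hray : ∀ᶠ s : ℝ in atTop, 1 ≤ ((s : ℂ) * z).re := by
    filter_upwards [eventually_ge_atTop z.re⁻¹] with s hs
    rw [Complex.re_ofReal_mul]
    exact (inv_le_iff_one_le_mul₀ hz).1 hs
  have hO : ∀ m : ℤ, (fun s : ℝ => abramowitzJ m (s * z)) =O[atTop] fun s : ℝ => s⁻¹ := by
    intro m
    obtain ⟨C, hC, h⟩ := exists_norm_abramowitzJ_le m
    refine Asymptotics.IsBigO.of_bound (C / z.re) ?_
    filter_upwards [hray, eventually_gt_atTop 0] with s hs hs0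
    refine (h _ hs).trans (le_of_eq ?_)
    rw [Complex.re_ofReal_mul, Real.norm_of_nonneg (by positivity)]
    field_simp
  have hz' : ∀ m : ℤ, Tendsto (fun s : ℝ => abramowitzJ m (s * z)) atTop (𝓝 0) := fun m =>
    (hO m).trans_tendsto tendsto_inv_atTop_zero
  have hbdd : ∀ m : ℤ, (fun s : ℝ => (s : ℂ) * abramowitzJ m (s * z)) =O[atTop]
      fun _ => (1 : ℝ) := by
    intro m
    have hs : (fun s : ℝ => (s : ℂ)) =O[atTop] fun s : ℝ => s :=
      Asymptotics.IsBigO.of_bound 1 (by simp)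
    refine (hs.mul (hO m)).trans_eventuallyEq ?_
    filter_upwards [eventually_gt_atTop 0] with s hs0 using mul_inv_cancel₀ hs0.ne'
  have hprod : ∀ m l : ℤ, Tendsto
      (fun s : ℝ => (s : ℂ) * abramowitzJ m (s * z) * star (abramowitzJ l (s * z)))
      atTop (𝓝 0) := by
    intro m l
    have hl : (fun s : ℝ => star (abramowitzJ l (s * z))) =o[atTop] fun _ => (1 : ℝ) := by
      refine (Asymptotics.isLittleO_one_iff ℝ).2 ?_
      simpa using (hz' l).star
    simpa using (Asymptotics.isLittleO_one_iff ℝ).1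
      (((hbdd m).mul_isLittleO hl).congr_right fun _ => one_mul (1 : ℝ))
  have h := (((hprod (n - 2) n).const_mul (z ^ 2)).sub
    ((hprod (n - 1) (n - 1)).const_mul (z * star z / 2))).add
    (((hz' (n - 1)).mul (hz' n).star).const_mul (n * z))
  have hre := (Complex.continuous_re.tendsto _).comp h
  simp only [mul_zero, star_zero, sub_zero, add_zero, Complex.zero_re] at hre
  refine hre.congr fun s => ?_
  simp only [abramowitzEnergy, Function.comp_apply, star_mul']
  congr 1
  ring

theorem abramowitzJ_ne_zero_in_sector (n : ℤ) (hn : 0 ≤ n) (z : ℂ) (hz : z ≠ 0)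
    (harg : |Complex.arg z| ≤ Real.pi / 4) : abramowitzJ n z ≠ 0 := by
  intro hzero
  have hre : 0 < z.re := by
    have h : |Complex.arg z| < Real.pi / 2 := by linarith [Real.pi_pos]
    exact (Complex.abs_arg_lt_pi_div_two_iff.1 h).resolve_right hz
  have hsq : 0 ≤ (z ^ 2).re := by
    have hcos : 0 ≤ Real.cos (2 * Complex.arg z) := by
      obtain ⟨h1, h2⟩ := abs_le.1 harg
      exact Real.cos_nonneg_of_mem_Icc ⟨by linarith, by linarith⟩
    have h1 := Complex.norm_mul_cos_arg z
    have h2 := Complex.norm_mul_sin_arg z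
    have h3 : (z ^ 2).re = ‖z‖ ^ 2 * Real.cos (2 * Complex.arg z) := by
      rw [Real.cos_two_mul', sq z, Complex.mul_re, ← h1, ← h2]
      ring
    rw [h3]
    positivity
  have hnR : (0 : ℝ) ≤ n := by exact_mod_cast hn
  have hderiv : ∀ s : ℝ, 1 ≤ s → HasDerivAt (abramowitzEnergy n z) _ s := fun s hs =>
    hasDerivAt_abramowitzEnergy n hre (by linarith)
  have hanti : AntitoneOn (abramowitzEnergy n z) (Set.Ici 1) := by
    refine antitoneOn_of_deriv_nonpos (convex_Ici 1)
      (fun s hs => (hderiv s hs).continuousAt.continuousWithinAt) ?_ ?_ <;>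
      rw [interior_Ici] <;> intro s hs
    · exact (hderiv s (Set.mem_Ioi.1 hs).le).differentiableAt.differentiableWithinAt
    · rw [(hderiv s (Set.mem_Ioi.1 hs).le).deriv]
      exact neg_nonpos.2 (by positivity)
  have hnonneg : ∀ s : ℝ, 1 ≤ s → 0 ≤ abramowitzEnergy n z s := by
    intro s hs
    refine le_of_tendsto (tendsto_abramowitzEnergy n hre) ?_
    filter_upwards [eventually_ge_atTop s] with r hr
    exact hanti hs (hs.trans hr) hr
  have hone : abramowitzEnergy n z 1 ≤ 0 := by
    have h : abramowitzEnergy n z 1 = -(‖z * abramowitzJ (n - 1) z‖ ^ 2 / 2) := by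
      simp only [abramowitzEnergy, Complex.ofReal_one, one_mul, hzero, star_zero, mul_zero,
        zero_sub, add_zero]
      rw [Complex.star_def, Complex.mul_conj, Complex.normSq_eq_norm_sq]
      norm_cast
    rw [h]
    exact neg_nonpos.2 (by positivity)
  have henergy : ∀ s : ℝ, 1 ≤ s → abramowitzEnergy n z s = 0 := fun s hs =>
    le_antisymm ((hanti (Set.mem_Ici.2 le_rfl) hs hs).trans hone) (hnonneg s hs)
  obtain ⟨s, hs, hne⟩ := exists_abramowitzJ_real_mul_ne_zero (n - 1) hre
  have hconst : HasDerivAt (abramowitzEnergy n z) 0 s := by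
    refine (hasDerivAt_const s (0 : ℝ)).congr_of_eventuallyEq ?_
    filter_upwards [eventually_gt_nhds hs] with r hr using henergy r hr.le
  have heq := (hderiv s hs.le).unique hconst
  have hpos : 0 < ‖z * abramowitzJ (n - 1) (s * z)‖ := norm_pos_iff.2 (mul_ne_zero hz hne)
  have : 0 < 2 * (z ^ 2).re * ‖abramowitzJ n (s * z)‖ ^ 2
      + (n + 1 / 2) * ‖z * abramowitzJ (n - 1) (s * z)‖ ^ 2 := by positivity
  linarith
end

section
/- Let a, b : ℕ → ℝ be the sequences defined by a 0 = 0, a 1 = 0, a 2 = −1, a k = −2·a (k−2) / (k·(k−1)·(k−2)) for k ≥ 3, and b 0 = 1, b 1 = −√π, b 2 = 3·(1−γ)/2 where γ is the Euler–Mascheroni constant, b k = −(2·b (k−2) + (3k² − 6k + 2)·a k) / (k·(k−1)·(k−2)) for k ≥ 3. Then for every complex number z, the series ∑_{k=0}^∞ b k · z^k is (absolutely) summable; that is, the power series with coefficients b k has infinite radius of convergence. -/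
/-- The logarithmic coefficients `a k` in the series expansion of `2 J₁`. -/
noncomputable def abramowitzA : ℕ → ℝ
  | 0 => 0
  | 1 => 0
  | 2 => -1
  | (k + 3) =>
      -2 * abramowitzA (k + 1) / (((k : ℝ) + 3) * ((k : ℝ) + 2) * ((k : ℝ) + 1))

/-- The coefficients `b k` in the series expansion of `2 J₁`. -/
noncomputable def abramowitzB : ℕ → ℝ
  | 0 => 1
  | 1 => -Real.sqrt Real.pi
  | 2 => 3 * (1 - Real.eulerMascheroniConstant) / 2
  | (k + 3) =>
      -(2 * abramowitzB (k + 1)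
          + (3 * ((k : ℝ) + 3) ^ 2 - 6 * ((k : ℝ) + 3) + 2) * abramowitzA (k + 3))
        / (((k : ℝ) + 3) * ((k : ℝ) + 2) * ((k : ℝ) + 1))

theorem abs_abramowitzA_mul_factorial_le :
    ∀ k : ℕ, |abramowitzA k| * (k.factorial : ℝ) ≤ 2 ^ k
  | 0 => by simp [abramowitzA]
  | 1 => by simp [abramowitzA]
  | 2 => by norm_num [abramowitzA]
  | (k + 3) => by
    have ih := abs_abramowitzA_mul_factorial_le (k + 1)
    have hk : (1 : ℝ) ≤ (k : ℝ) + 1 := by linarith [k.cast_nonneg (α := ℝ)]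
    have h : |abramowitzA (k + 3)| * ((k + 3).factorial : ℝ)
        = 2 * (|abramowitzA (k + 1)| * ((k + 1).factorial : ℝ)) / ((k : ℝ) + 1) := by
      have hd : (0 : ℝ) < ((k : ℝ) + 3) * ((k : ℝ) + 2) * ((k : ℝ) + 1) := by positivity
      rw [abramowitzA, abs_div, abs_of_pos hd, abs_mul, abs_neg, abs_two,
        Nat.factorial_succ (k + 2), Nat.factorial_succ (k + 1)]
      push_cast
      field_simp
      ring
    rw [h]
    calc 2 * (|abramowitzA (k + 1)| * ((k + 1).factorial : ℝ)) / ((k : ℝ) + 1)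
        ≤ 2 * (|abramowitzA (k + 1)| * ((k + 1).factorial : ℝ)) :=
          div_le_self (by positivity) hk
      _ ≤ 2 * 2 ^ (k + 1) := by gcongr
      _ ≤ 2 ^ (k + 3) := by
          have : (0 : ℝ) < 2 ^ k := by positivity
          rw [pow_add, pow_add]
          linarith

theorem abs_abramowitzB_mul_factorial_le :
    ∀ k : ℕ, |abramowitzB k| * (k.factorial : ℝ) ≤ 6 * 2 ^ k
  | 0 => by norm_num [abramowitzB]
  | 1 => by
    have h : Real.sqrt Real.pi ≤ 12 :=
      Real.sqrt_le_iff.mpr ⟨by norm_num, by linarith [Real.pi_lt_four]⟩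
    norm_num [abramowitzB, abs_of_nonneg (Real.sqrt_nonneg _), h]
  | 2 => by
    have h₁ := Real.one_half_lt_eulerMascheroniConstant
    have h₂ := Real.eulerMascheroniConstant_lt_two_thirds
    have h : |abramowitzB 2| ≤ 12 := by
      rw [abramowitzB, abs_le]
      constructor <;> linarith
    norm_num
    linarith
  | (k + 3) => by
    have ih := abs_abramowitzB_mul_factorial_le (k + 1)
    have hA := abs_abramowitzA_mul_factorial_le (k + 3)
    have hk : (0 : ℝ) ≤ k := k.cast_nonneg
    set d : ℝ := ((k : ℝ) + 3) * ((k : ℝ) + 2) * ((k : ℝ) + 1) with hd_def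
    set p : ℝ := 3 * ((k : ℝ) + 3) ^ 2 - 6 * ((k : ℝ) + 3) + 2 with hp_def
    have hd : 0 < d := by positivity
    have hp : 0 ≤ p := by rw [hp_def]; nlinarith
    have hpd : p / d ≤ 3 := by
      rw [div_le_iff₀ hd, hp_def, hd_def]
      nlinarith [pow_nonneg hk 3, pow_nonneg hk 2]
    have hfac : ((k + 3).factorial : ℝ) / d = ((k + 1).factorial : ℝ) / ((k : ℝ) + 1) := by
      rw [hd_def, Nat.factorial_succ (k + 2), Nat.factorial_succ (k + 1)]
      push_cast
      field_simp
      ring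
    have hfac_le : ((k + 3).factorial : ℝ) / d ≤ ((k + 1).factorial : ℝ) := by
      rw [hfac]
      exact div_le_self (by positivity) (by linarith)
    have habs : |abramowitzB (k + 3)|
        ≤ (2 * |abramowitzB (k + 1)| + p * |abramowitzA (k + 3)|) / d := by
      rw [abramowitzB, abs_div, abs_of_pos hd, abs_neg]
      gcongr
      refine (abs_add_le _ _).trans_eq ?_
      rw [abs_mul, abs_mul, abs_two, abs_of_nonneg hp]
    calc |abramowitzB (k + 3)| * ((k + 3).factorial : ℝ)
        ≤ (2 * |abramowitzB (k + 1)| + p * |abramowitzA (k + 3)|) / d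
            * ((k + 3).factorial : ℝ) := by gcongr
      _ = 2 * (|abramowitzB (k + 1)| * (((k + 3).factorial : ℝ) / d))
            + p / d * (|abramowitzA (k + 3)| * ((k + 3).factorial : ℝ)) := by ring
      _ ≤ 2 * (|abramowitzB (k + 1)| * ((k + 1).factorial : ℝ)) + 3 * 2 ^ (k + 3) := by
          gcongr
      _ ≤ 2 * (6 * 2 ^ (k + 1)) + 3 * 2 ^ (k + 3) := by gcongr
      _ = 6 * 2 ^ (k + 3) := by ring

theorem abramowitzB_series_summable (z : ℂ) :
    Summable fun k : ℕ => ‖(abramowitzB k : ℂ) * z ^ k‖ := by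
  refine Summable.of_nonneg_of_le (fun _ => norm_nonneg _) (fun k => ?_)
    ((Real.summable_pow_div_factorial (2 * ‖z‖)).mul_left 6)
  have hb : |abramowitzB k| ≤ 6 * 2 ^ k / (k.factorial : ℝ) := by
    rw [le_div_iff₀ (by positivity)]
    exact abs_abramowitzB_mul_factorial_le k
  rw [norm_mul, norm_pow, Complex.norm_real, Real.norm_eq_abs]
  calc |abramowitzB k| * ‖z‖ ^ k ≤ 6 * 2 ^ k / (k.factorial : ℝ) * ‖z‖ ^ k := by gcongr
    _ = 6 * ((2 * ‖z‖) ^ k / (k.factorial : ℝ)) := by rw [mul_pow]; ring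
end
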